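/- arXiv:math/0306039 — 5 statements merged into one kernel-verified Lean document; each statement's English description precedes it below -/
import Mathlib

section
/- Let G be an innately transitive permutation group on a finite set Ω with plinth M (i.e. M is a transitive minimal normal subgroup of G). If {Γ₁,…,Γ_ℓ} is a G-invariant Cartesian decomposition of Ω, then each Γ_i is an M-invariant partition of Ω (i.e. M fixes each partition Γ_i setwise, permuting its parts). -/
open scoped Pointwise

/-- A Cartesian decomposition of a finite set identifies the set with the product of its
partitions, so its cardinality is the product of the numbers of parts. -/
theorem card_eq_prod_of_cartesian {Ω : Type*} [Finite Ω] (E : Set (Set (Set Ω))) [Fintype E]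
    (hpart : ∀ P ∈ E, Setoid.IsPartition P)
    (hcart : ∀ γ : E → Set Ω, (∀ P : E, γ P ∈ (P : Set (Set Ω))) →
        (⋂ P : E, γ P).ncard = 1) :
    Nat.card Ω = ∏ P : E, (P : Set (Set Ω)).ncard := by
  choose part hpart_mem hpart_unique using fun (P : E) (ω : Ω) => (hpart P P.2).2 ω
  have hbij : Function.Bijective
      (fun (ω : Ω) (P : E) => (⟨part P ω, (hpart_mem P ω).1⟩ : (P : Set (Set Ω)))) := by
    constructor
    · intro a b hab
      obtain ⟨c, hc⟩ := Set.ncard_eq_one.mp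
        (hcart (fun P => part P a) (fun P => (hpart_mem P a).1))
      have ha : a ∈ ⋂ P : E, part P a := Set.mem_iInter.mpr fun P => (hpart_mem P a).2
      have hb : b ∈ ⋂ P : E, part P a := Set.mem_iInter.mpr fun P => by
        have h : part P a = part P b := congrArg Subtype.val (congrFun hab P)
        rw [h]
        exact (hpart_mem P b).2
      rw [hc] at ha hb
      exact ha.trans hb.symm
    · intro γ
      obtain ⟨c, hc⟩ := Set.ncard_eq_one.mp
        (hcart (fun P => (γ P : Set Ω)) (fun P => (γ P).2))
      have hmem : c ∈ ⋂ P : E, (γ P : Set Ω) := hc ▸ rfl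
      refine ⟨c, funext fun P => Subtype.ext ?_⟩
      exact (hpart_unique P c _ ⟨(γ P).2, Set.mem_iInter.mp hmem P⟩).symm
  rw [Nat.card_congr (Equiv.ofBijective _ hbij), Nat.card_pi]
  rfl

/-- For `k ≠ 1` and `n ≥ 1`, the power `k ^ n` does not divide `n !`. -/
theorem not_pow_dvd_factorial {k n : ℕ} (hk : k ≠ 1) (hn : n ≠ 0) :
    ¬ k ^ n ∣ n.factorial := by
  intro h
  obtain ⟨p, hp, hpk⟩ := Nat.exists_prime_and_dvd hk
  have := Fact.mk hp
  have hdvd : p ^ n ∣ n.factorial := (pow_dvd_pow_of_dvd hpk n).trans h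
  have hle : n ≤ padicValNat p n.factorial :=
    (padicValNat_dvd_iff_le n.factorial_ne_zero).mp hdvd
  have hval := sub_one_mul_padicValNat_factorial_lt_of_ne_zero p hn
  have hp1 : 1 ≤ p - 1 := Nat.le_sub_one_of_lt hp.one_lt
  nlinarith

/-- A transitive subgroup of permutations of a nonempty set has order divisible by the degree. -/
theorem card_dvd_card_of_transitive {Ω : Type*} [Finite Ω] [Nonempty Ω]
    (M : Subgroup (Equiv.Perm Ω)) (hM : ∀ ω₁ ω₂ : Ω, ∃ m ∈ M, m ω₁ = ω₂) :
    Nat.card Ω ∣ Nat.card M := by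
  have : MulAction.IsPretransitive M Ω :=
    ⟨fun a b => let ⟨m, hm, h⟩ := hM a b; ⟨⟨m, hm⟩, h⟩⟩
  rw [← MulAction.index_stabilizer_of_transitive M (Classical.arbitrary Ω)]
  exact Subgroup.index_dvd_card _

/-- The partition into a single part is fixed by every permutation. -/
theorem smul_eq_of_isPartition_of_ncard_eq_one {Ω : Type*} {P : Set (Set Ω)}
    (hP : Setoid.IsPartition P) (hcard : P.ncard = 1) (g : Equiv.Perm Ω) : g • P = P := by
  obtain ⟨s, rfl⟩ := Set.ncard_eq_one.mp hcard
  have hs : s = Set.univ := Set.eq_univ_of_forall fun ω => by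
    obtain ⟨t, ⟨ht, hω⟩, -⟩ := hP.2 ω
    rwa [Set.mem_singleton_iff.mp ht] at hω
  rw [hs, Set.smul_set_singleton, Set.smul_set_univ]


/-- Let `G` be an innately transitive permutation group on a
finite set `Ω` with plinth `M` (a transitive minimal normal subgroup of `G`).
If `{Γ₁, …, Γ_ℓ}` is a `G`-invariant Cartesian decomposition of `Ω`, then each
`Γ ∈ E` is an `M`-invariant partition of `Ω`. -/
theorem plinth_leaves_each_partition_invariant
    {Ω : Type*} [Fintype Ω] (G M : Subgroup (Equiv.Perm Ω))
    -- `G` is transitive on `Ω`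
    (hGtrans : ∀ ω₁ ω₂ : Ω, ∃ g ∈ G, g ω₁ = ω₂)
    -- `M` is a transitive minimal normal subgroup of `G` (a plinth)
    (hMG : M ≤ G)
    (hMtrans : ∀ ω₁ ω₂ : Ω, ∃ m ∈ M, m ω₁ = ω₂)
    (hMne : M ≠ ⊥)
    (hMnormal : ∀ g ∈ G, ∀ m ∈ M, g * m * g⁻¹ ∈ M)
    (hMmin : ∀ N : Subgroup (Equiv.Perm Ω), N ≤ M → N ≠ ⊥ →
        (∀ g ∈ G, ∀ n ∈ N, g * n * g⁻¹ ∈ N) → N = M)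
    -- `E` is a `G`-invariant Cartesian decomposition of `Ω`
    (E : Set (Set (Set Ω)))
    (hpart : ∀ P ∈ E, Setoid.IsPartition P)
    (hcart : ∀ γ : E → Set Ω, (∀ P : E, γ P ∈ (P : Set (Set Ω))) →
        (⋂ P : E, γ P).ncard = 1)
    (hGinv : ∀ g ∈ G, ∀ P ∈ E, (fun s : Set Ω => g '' s) '' P ∈ E) :
    -- then each partition in `E` is `M`-invariant
    ∀ P ∈ E, ∀ m ∈ M, ∀ γ ∈ P, (m '' γ) ∈ P := by
  classical
  have key : ∀ P ∈ E, ∀ m ∈ M, m • P = P := by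
    intro P hP m₀ hm₀
    by_contra hne
    have hΩ : Nonempty Ω := by
      by_contra h
      rw [not_nonempty_iff] at h
      exact hne (by rw [Subsingleton.elim m₀ 1, one_smul])
    let F : Set (Set (Set Ω)) := MulAction.orbit G P
    have hFE : F ⊆ E := by
      rintro _ ⟨g, rfl⟩
      exact hGinv g g.2 P hP
    have hFcard : ∀ Q ∈ F, Q.ncard = P.ncard := by
      rintro _ ⟨g, rfl⟩
      exact Set.ncard_smul_set (g : Equiv.Perm Ω) P
    let φ : M →* Equiv.Perm F :=
      (MulAction.toPermHom G F).comp (Subgroup.inclusion hMG)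
    have hφ : ∀ m : M, φ m = 1 ↔ ∀ Q ∈ F, (m : Equiv.Perm Ω) • Q = Q := by
      intro m
      rw [Equiv.ext_iff, Subtype.forall]
      exact forall₂_congr fun Q hQ => Subtype.ext_iff
    have hker : φ.ker.map M.subtype = ⊥ := by
      by_contra hN
      have hNM := hMmin _ (Subgroup.map_subtype_le _) hN (by
        rintro g hg _ ⟨n, hn, rfl⟩
        refine ⟨⟨g * n * g⁻¹, hMnormal g hg n n.2⟩, ?_, rfl⟩
        have hn' := (hφ n).mp hn
        refine (hφ _).mpr fun Q hQ => ?_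
        have hQ' : g⁻¹ • Q ∈ F := MulAction.mem_orbit_of_mem_orbit (⟨g, hg⟩⁻¹ : G) hQ
        change (g * n * g⁻¹) • Q = Q
        rw [mul_smul, mul_smul, hn' _ hQ', smul_inv_smul])
      rw [← hNM] at hm₀
      obtain ⟨n, hn, rfl⟩ := hm₀
      exact hne ((hφ n).mp hn P (MulAction.mem_orbit_self P))
    have hinj : Function.Injective φ := (MonoidHom.ker_eq_bot_iff φ).mp
      ((Subgroup.map_eq_bot_iff_of_injective _ M.subtype_injective).mp hker)
    have hMF : Nat.card M ∣ (Nat.card F).factorial := by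
      rw [← Nat.card_perm]
      exact Subgroup.card_dvd_of_injective φ hinj
    have hpow : P.ncard ^ Nat.card F ∣ Nat.card Ω := by
      rw [card_eq_prod_of_cartesian E hpart hcart]
      have hsub : ∏ Q : F, (Q : Set (Set Ω)).ncard = P.ncard ^ Nat.card F := by
        rw [Finset.prod_congr rfl fun (Q : F) _ => hFcard Q Q.2, Finset.prod_const,
          Finset.card_univ, Nat.card_eq_fintype_card]
      have hmap := Finset.prod_map (Finset.univ : Finset F)
        ⟨Set.inclusion hFE, Set.inclusion_injective hFE⟩
        (fun Q : E => (Q : Set (Set Ω)).ncard)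
      rw [← hsub]
      refine (dvd_of_eq hmap.symm).trans ?_
      exact Finset.prod_dvd_prod_of_subset _ _ _ (Finset.subset_univ _)
    have : Nonempty F := ⟨⟨P, MulAction.mem_orbit_self P⟩⟩
    exact not_pow_dvd_factorial
      (fun h => hne (smul_eq_of_isPartition_of_ncard_eq_one (hpart P hP) h m₀))
      Nat.card_pos.ne'
      ((hpow.trans (card_dvd_card_of_transitive M hMtrans)).trans hMF)
  intro P hP m hm γ hγ
  have h : m • γ ∈ m • P := Set.smul_mem_smul_set hγ
  rwa [key P hP m hm] at h
end

section
/- The alternating group T = A₆ (the alternating group on 6 points) contains subgroups K₁ and K₂, both isomorphic to the alternating group A₅ (hence of index 6 in T), such that K₁ · K₂ = T (as a subset product) and the intersection K₁ ∩ K₂ has order 10 (isomorphic to the dihedral group D₁₀ of order 10). Consequently {K₁, K₂} satisfies the Cartesian system conditions K₁K₂ = T and K₁ ∩ K₂ = T_ω for the transitive action of T on the 36 cosets of K₁ ∩ K₂. -/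
open Pointwise

open Equiv MulAction

/-- The action of the dihedral group of order `2n` on the vertices `ZMod n` of an `n`-gon. -/
def dihedralToPerm (n : ℕ) : DihedralGroup n →* Perm (ZMod n) where
  toFun
    | .r i => Equiv.addRight i
    | .sr i => Equiv.subLeft (-i)
  map_one' := by
    rw [DihedralGroup.one_def]
    ext x
    simp
  map_mul' := by
    rintro (i | i) (j | j) <;> ext x <;> simp <;> ring

lemma sign_dihedralToPerm_five (d : DihedralGroup 5) : Perm.sign (dihedralToPerm 5 d) = 1 := by
  rcases d with i | i <;> revert i <;> decide

lemma dihedralToPerm_five_injective : Function.Injective (dihedralToPerm 5) := by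
  rw [injective_iff_map_eq_one]
  rintro (i | i) h
  · have := Equiv.congr_fun h 0
    have hi : i = 0 := by simpa [dihedralToPerm] using this
    rw [hi, DihedralGroup.one_def]
  · have h₀ := Equiv.congr_fun h 0
    have h₁ := Equiv.congr_fun h 1
    simp only [dihedralToPerm, MonoidHom.coe_mk, OneHom.coe_mk, Equiv.subLeft_apply,
      Perm.coe_one, id_eq] at h₀ h₁
    revert h₀ h₁
    revert i
    decide

/-- The embedding of the dihedral group of order 10 in `A₅`. -/
def dihedralToAlternating : DihedralGroup 5 →* alternatingGroup (Fin 5) :=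
  ((ZMod.finEquiv 5).symm.toEquiv.permCongrHom.toMonoidHom.comp (dihedralToPerm 5)).codRestrict
    (alternatingGroup (Fin 5)) fun d ↦ Perm.mem_alternatingGroup.2 <|
      (Perm.sign_permCongr _ _).trans (sign_dihedralToPerm_five d)

lemma dihedralToAlternating_injective : Function.Injective dihedralToAlternating := fun _ _ h ↦
  dihedralToPerm_five_injective <|
    (ZMod.finEquiv 5).symm.toEquiv.permCongrHom.injective <| congrArg Subtype.val h

lemma nat_card_alternatingGroup_fin_five : Nat.card (alternatingGroup (Fin 5)) = 60 := by
  rw [nat_card_alternatingGroup, Nat.card_fin]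
  rfl

lemma nat_card_alternatingGroup_fin_six : Nat.card (alternatingGroup (Fin 6)) = 360 := by
  rw [nat_card_alternatingGroup, Nat.card_fin]
  rfl

lemma index_range_dihedralToAlternating : dihedralToAlternating.range.index = 6 := by
  have h := dihedralToAlternating.range.card_mul_index
  rw [nat_card_alternatingGroup_fin_five,
    ← Nat.card_congr (dihedralToAlternating.ofInjective dihedralToAlternating_injective).toEquiv,
    DihedralGroup.nat_card] at h
  lia

lemma IsSimpleGroup.injective_of_ne_one {G H : Type*} [Group G] [Group H] [IsSimpleGroup G]
    (f : G →* H) (hf : f ≠ 1) : Function.Injective f := by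
  rw [← MonoidHom.ker_eq_bot_iff]
  refine f.normal_ker.eq_bot_or_eq_top.resolve_right fun h ↦ hf ?_
  rwa [MonoidHom.ker_eq_top_iff] at h

lemma exists_transitive_hom_alternatingGroup :
    ∃ (f : alternatingGroup (Fin 5) →* alternatingGroup (Fin 6)) (ω : Fin 6),
      Function.Injective f ∧ (∀ x, ∃ g, f g • ω = x) ∧
      ∀ d, f (dihedralToAlternating d) • ω = ω := by
  set D := dihedralToAlternating.range
  have hD : Nat.card (alternatingGroup (Fin 5) ⧸ D) = 6 := index_range_dihedralToAlternating
  let e : alternatingGroup (Fin 5) ⧸ D ≃ Fin 6 := Finite.equivFinOfCardEq hD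
  let F : alternatingGroup (Fin 5) →* Perm (Fin 6) :=
    e.permCongrHom.toMonoidHom.comp (toPermHom (alternatingGroup (Fin 5)) (_ ⧸ D))
  have hF (g x) : F g x = e (g • e.symm x) := rfl
  have hsign : Perm.sign.comp F = 1 := by
    by_contra h
    have := Nat.card_le_card_of_injective _ (IsSimpleGroup.injective_of_ne_one _ h)
    rw [nat_card_alternatingGroup_fin_five, Nat.card_eq_fintype_card,
      Fintype.card_units_int] at this
    lia
  let f := F.codRestrict (alternatingGroup (Fin 6)) fun g ↦
    Perm.mem_alternatingGroup.2 (DFunLike.congr_fun hsign g)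
  have hf (g x) : f g • x = e (g • e.symm x) := rfl
  have htrans (x) : ∃ g, f g • e (1 : alternatingGroup (Fin 5)) = x := by
    obtain ⟨g, hg⟩ := QuotientGroup.mk_surjective (e.symm x)
    refine ⟨g, ?_⟩
    rw [hf, e.symm_apply_apply, Quotient.smul_coe, smul_eq_mul, mul_one, hg, e.apply_symm_apply]
  refine ⟨f, e (1 : alternatingGroup (Fin 5)), IsSimpleGroup.injective_of_ne_one f ?_, htrans, ?_⟩
  · intro h
    obtain ⟨x, hx⟩ := exists_ne (e (1 : alternatingGroup (Fin 5)))
    obtain ⟨g, hg⟩ := htrans x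
    rw [h, MonoidHom.one_apply, one_smul] at hg
    exact hx hg.symm
  · intro d
    rw [hf, e.symm_apply_apply, Quotient.smul_coe, smul_eq_mul, mul_one]
    congr 1
    rw [eq_comm, QuotientGroup.eq, inv_one, one_mul]
    exact ⟨d, rfl⟩

lemma exists_injective_hom_stabilizer (ω : Fin 6) :
    ∃ g : alternatingGroup (Fin 5) →* stabilizer (alternatingGroup (Fin 6)) ω,
      Function.Injective g := by
  let e : Fin 5 ≃ {x : Fin 6 // x ≠ ω} := finSuccAboveEquiv ω
  let F : alternatingGroup (Fin 5) →* alternatingGroup (Fin 6) :=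
    ((Perm.extendDomainHom e).comp (alternatingGroup (Fin 5)).subtype).codRestrict
      (alternatingGroup (Fin 6)) fun g ↦ Perm.mem_alternatingGroup.2 <| by
        simpa [Perm.sign_extendDomain] using Perm.mem_alternatingGroup.1 g.2
  refine ⟨F.codRestrict _ fun g ↦ ?_, fun a b h ↦ ?_⟩
  · exact Perm.extendDomain_apply_not_subtype _ e (by simp)
  · exact Subtype.ext <| Perm.extendDomainHom_injective e <|
      congrArg (fun k : stabilizer (alternatingGroup (Fin 6)) ω ↦ (k.1 : Perm (Fin 6))) h

lemma MonoidHom.nonempty_mulEquiv_of_injective_of_card_eq {G H : Type*} [Group G] [Group H]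
    [Finite H] (f : G →* H) (hf : Function.Injective f) (h : Nat.card G = Nat.card H) :
    Nonempty (H ≃* G) :=
  ⟨(MulEquiv.ofBijective f <| (Nat.bijective_iff_injective_and_card f).2 ⟨hf, h⟩).symm⟩

lemma MulAction.stabilizer_mul_eq_univ {G X : Type*} [Group G] [MulAction G X] (K : Subgroup G)
    (ω : X) (h : ∀ x, ∃ k ∈ K, k • ω = x) : (stabilizer G ω : Set G) * (K : Set G) = Set.univ := by
  refine Set.eq_univ_of_forall fun t ↦ ?_
  obtain ⟨k, hk, hkω⟩ := h (t⁻¹ • ω)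
  exact ⟨t * k, by simp [mem_stabilizer_iff, mul_smul, hkω], k⁻¹, inv_mem hk, by simp⟩

/-- The alternating group `T = A₆` contains subgroups
`K₁, K₂`, both isomorphic to `A₅` (hence of index 6 in `T`), with `K₁K₂ = T`
(subset product) and `|K₁ ∩ K₂| = 10`, with `K₁ ∩ K₂ ≅ D₁₀` dihedral of order
10.  Consequently `{K₁, K₂}` satisfies the Cartesian system conditions
`K₁K₂ = T` and `K₁ ∩ K₂ = T_ω` for the transitive action of `T` on the 36
cosets of `K₁ ∩ K₂`. -/
theorem alt6_cartesian_system_example :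
    ∃ K₁ K₂ : Subgroup (alternatingGroup (Fin 6)),
      Nonempty (K₁ ≃* alternatingGroup (Fin 5)) ∧
      Nonempty (K₂ ≃* alternatingGroup (Fin 5)) ∧
      K₁.index = 6 ∧ K₂.index = 6 ∧
      (K₁ : Set (alternatingGroup (Fin 6))) * (K₂ : Set (alternatingGroup (Fin 6))) =
        Set.univ ∧
      Nat.card (K₁ ⊓ K₂ : Subgroup (alternatingGroup (Fin 6))) = 10 ∧
      Nonempty ((K₁ ⊓ K₂ : Subgroup (alternatingGroup (Fin 6))) ≃* DihedralGroup 5) ∧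
      Nat.card ((alternatingGroup (Fin 6)) ⧸ (K₁ ⊓ K₂)) = 36 ∧
      MulAction.stabilizer (alternatingGroup (Fin 6))
          (QuotientGroup.mk 1 : (alternatingGroup (Fin 6)) ⧸ (K₁ ⊓ K₂)) = K₁ ⊓ K₂ := by
  obtain ⟨f, ω, hf, htrans, hdih⟩ := exists_transitive_hom_alternatingGroup
  set K₁ := stabilizer (alternatingGroup (Fin 6)) ω with hK₁
  have hK₂card : Nat.card f.range = 60 := by
    rw [← Nat.card_congr (f.ofInjective hf).toEquiv, nat_card_alternatingGroup_fin_five]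
  have hK₁index : K₁.index = 6 := by
    have h : orbit (alternatingGroup (Fin 6)) ω = Set.univ :=
      Set.eq_univ_of_forall fun x ↦ (htrans x).elim fun a ha ↦ ⟨f a, ha⟩
    rw [hK₁, index_stabilizer, h, Set.ncard_univ, Nat.card_fin]
  have hK₁card : Nat.card K₁ = 60 := by
    have h := K₁.card_mul_index
    rw [hK₁index, nat_card_alternatingGroup_fin_six] at h
    lia
  have hK₂index : f.range.index = 6 := by
    have h := f.range.card_mul_index
    rw [hK₂card, nat_card_alternatingGroup_fin_six] at h
    lia
  have hrel : K₁.relIndex f.range = 6 := by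
    have h : orbit f.range ω = Set.univ :=
      Set.eq_univ_of_forall fun x ↦ (htrans x).elim fun a ha ↦ ⟨⟨f a, a, rfl⟩, ha⟩
    have h' : K₁.subgroupOf f.range = stabilizer f.range ω := rfl
    rw [Subgroup.relIndex, h', index_stabilizer, h, Set.ncard_univ, Nat.card_fin]
  have hindex : (K₁ ⊓ f.range).index = 36 := by
    rw [← Subgroup.inf_relIndex_right] at hrel
    rw [← Subgroup.relIndex_mul_index (inf_le_right : K₁ ⊓ f.range ≤ f.range), hrel, hK₂index]
  have hcard : Nat.card (K₁ ⊓ f.range : Subgroup (alternatingGroup (Fin 6))) = 10 := by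
    have h := (K₁ ⊓ f.range).card_mul_index
    rw [hindex, nat_card_alternatingGroup_fin_six] at h
    lia
  refine ⟨K₁, f.range, ?_, ⟨(f.ofInjective hf).symm⟩, hK₁index, hK₂index, ?_, hcard, ?_, hindex,
    stabilizer_quotient _⟩
  · obtain ⟨g, hg⟩ := exists_injective_hom_stabilizer ω
    exact g.nonempty_mulEquiv_of_injective_of_card_eq hg <| by
      rw [hK₁card, nat_card_alternatingGroup_fin_five]
  · exact stabilizer_mul_eq_univ _ ω fun x ↦ (htrans x).elim fun a ha ↦ ⟨f a, ⟨a, rfl⟩, ha⟩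
  · let φ := (f.comp dihedralToAlternating).codRestrict (K₁ ⊓ f.range) fun d ↦ ⟨hdih d, _, rfl⟩
    refine φ.nonempty_mulEquiv_of_injective_of_card_eq (fun a b h ↦ ?_) ?_
    · exact dihedralToAlternating_injective <| hf <| congrArg Subtype.val h
    · rw [hcard, DihedralGroup.nat_card]
end

section
/- Let M = T₁ × ⋯ × T_k be a direct product of groups with coordinate projections σ_i : M → T_i, and let K₁,…,K_ℓ be subgroups of M satisfying K_j · (∏_{m≠j} K_m) = M for every j ∈ {1,…,ℓ} together with the Cartesian decomposition condition that the natural map M/(∩_j K_j) → ∏_j M/K_j is a bijection. Then for every i ∈ {1,…,k} and every j ∈ {1,…,ℓ}, the simple direct factor T_i admits the factorisation T_i = σ_i(K_j) · (∩_{m≠j} σ_i(K_m)). -/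
open Pointwise

/-- The subset product `∏_{m ≠ j} K_m` (in the natural index order) of a family
of subgroups. -/
def prodOfRest {G : Type*} [Group G] {ℓ : ℕ} (K : Fin ℓ → Subgroup G) (j : Fin ℓ) :
    Set G :=
  (((List.finRange ℓ).filter fun m => m ≠ j).map fun m => (K m : Set G)).prod

/-- If the diagonal map `G ⧸ ⨅ m, K m → ∏ m, G ⧸ K m` is surjective, then every element of `G`
is a product of an element of `K j` and an element lying in all the other subgroups `K m`. -/
theorem exists_mul_eq_of_surjective_quotientiInfEmbedding {G ι : Type*} [Group G]
    (K : ι → Subgroup G) (hK : Function.Surjective (Subgroup.quotientiInfEmbedding K))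
    (j : ι) (x : G) :
    ∃ a ∈ K j, ∃ b, (∀ m, m ≠ j → b ∈ K m) ∧ a * b = x := by
  classical
  obtain ⟨q, hq⟩ := hK fun m => (Function.update (1 : ι → G) j x⁻¹ m : G)
  obtain ⟨y, rfl⟩ := QuotientGroup.mk_surjective q
  have hy (m : ι) : (Function.update (1 : ι → G) j x⁻¹ m)⁻¹ * y ∈ K m :=
    QuotientGroup.eq.1 (congrFun hq m).symm
  refine ⟨x * y, ?_, y⁻¹, fun m hm => ?_, by group⟩
  · simpa using hy j
  · simpa [Function.update_of_ne hm] using hy m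

/-- Let `M = T₁ × ⋯ × T_k` with coordinate projections
`σ_i`, and let `K₁, …, K_ℓ ≤ M` satisfy `K_j ⬝ (∏_{m ≠ j} K_m) = M` for all
`j`, together with the Cartesian decomposition condition that the natural map
`M/(⋂_j K_j) → ∏_j M/K_j` is a bijection.  Then for all `i` and `j`,
`T_i = σ_i(K_j) ⬝ (⋂_{m ≠ j} σ_i(K_m))`. -/
theorem projections_give_factorisations
    {k ℓ : ℕ} {T : Fin k → Type*} [∀ i, Group (T i)]
    (K : Fin ℓ → Subgroup (∀ i, T i))
    (hfact : ∀ j, (K j : Set (∀ i, T i)) * prodOfRest K j = Set.univ)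
    (hbij : Function.Bijective (Subgroup.quotientiInfEmbedding K)) :
    ∀ (i : Fin k) (j : Fin ℓ),
      (((K j).map (Pi.evalMonoidHom T i) : Subgroup (T i)) : Set (T i)) *
        ((⨅ m : {m : Fin ℓ // m ≠ j}, (K m).map (Pi.evalMonoidHom T i)) : Set (T i)) =
        Set.univ := by
  intro i j
  refine Set.eq_univ_of_forall fun t => ?_
  obtain ⟨a, ha, b, hb, hab⟩ :=
    exists_mul_eq_of_surjective_quotientiInfEmbedding K hbij.surjective j (Pi.mulSingle i t)
  refine Set.mem_mul.2 ⟨a i, ⟨a, ha, rfl⟩, b i, ?_, ?_⟩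
  · exact Set.mem_iInter.2 fun m => ⟨b, hb m m.2, rfl⟩
  · rw [← Pi.mul_apply, hab, Pi.mulSingle_eq_same]
end

section
/- Let T be a group and let A, B be subgroups of T with T = A·B (subset product). Set M = T × T, K₁ = A × B, and K₂ = B × A. Then K₁ · K₂ = M and K₁ ∩ K₂ = (A∩B) × (A∩B). Hence, with respect to the transitive coset action of M on [M : K₁∩K₂] with ω the trivial coset, {K₁,K₂} is a Cartesian system of subgroups in M. -/
open Pointwise

/-- Let `T` be a group and `A, B ≤ T` with `T = A ⬝ B`
(subset product).  Set `M = T × T`, `K₁ = A × B` and `K₂ = B × A`.  Then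
`K₁ ⬝ K₂ = M` and `K₁ ∩ K₂ = (A ∩ B) × (A ∩ B)`.  Hence, for the transitive
coset action of `M` on `[M : K₁ ∩ K₂]` with `ω` the trivial coset, `{K₁, K₂}`
is a Cartesian system of subgroups in `M` with respect to `ω`. -/
theorem factorisation_cartesian_system_example
    {T : Type*} [Group T] (A B : Subgroup T)
    (hAB : (A : Set T) * (B : Set T) = Set.univ)
    (K₁ K₂ : Subgroup (T × T))
    (h₁ : K₁ = A.prod B) (h₂ : K₂ = B.prod A) :
    (K₁ : Set (T × T)) * (K₂ : Set (T × T)) = Set.univ ∧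
    K₁ ⊓ K₂ = (A ⊓ B).prod (A ⊓ B) ∧
    MulAction.stabilizer (T × T)
        (QuotientGroup.mk 1 : (T × T) ⧸ (K₁ ⊓ K₂)) = K₁ ⊓ K₂ := by
  subst h₁ h₂
  have hBA : (B : Set T) * (A : Set T) = Set.univ := by
    simpa [mul_inv_rev] using congrArg (·⁻¹) hAB
  refine ⟨?_, ?_, ?_⟩
  · rw [Subgroup.coe_prod, Subgroup.coe_prod, Set.prod_mul_prod_comm, hAB, hBA, Set.univ_prod_univ]
  · ext
    simp only [Subgroup.mem_inf, Subgroup.mem_prod]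
    tauto
  · exact MulAction.stabilizer_quotient _
end

section
/- Let T be a group and let A, B, C be subgroups of T forming a strong multiple factorisation, i.e. T = A·(B∩C) = B·(C∩A) = C·(A∩B) (subset products). Set M = T³, K₁ = A × B × C, K₂ = B × C × A, and K₃ = C × A × B. Then K₁ ∩ K₂ ∩ K₃ = (A∩B∩C) × (A∩B∩C) × (A∩B∩C), and for each i ∈ {1,2,3}, K_i · (K_j ∩ K_m) = M, where {j,m} = {1,2,3} ∖ {i}; moreover K_i · (∏_{j≠i} K_j) = M for every i. Hence {K₁,K₂,K₃} is a Cartesian system of subgroups in M with respect to the trivial coset ω in the coset action of M on [M : K₁∩K₂∩K₃]. -/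
open Pointwise

theorem Subgroup.prod_inf_prod {G H : Type*} [Group G] [Group H] (A C : Subgroup G)
    (B D : Subgroup H) : A.prod B ⊓ C.prod D = (A ⊓ C).prod (B ⊓ D) :=
  SetLike.coe_injective (by simp [Subgroup.coe_prod, Set.prod_inter_prod])

theorem Subgroup.coe_prod_mul_coe_prod_eq_univ {G H : Type*} [Group G] [Group H]
    {A C : Subgroup G} {B D : Subgroup H} (hAC : (A : Set G) * (C : Set G) = Set.univ)
    (hBD : (B : Set H) * (D : Set H) = Set.univ) :
    (A.prod B : Set (G × H)) * (C.prod D : Set (G × H)) = Set.univ := by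
  rw [Subgroup.coe_prod, Subgroup.coe_prod, Set.prod_mul_prod_comm, hAC, hBD, Set.univ_prod_univ]

/-- The intersection of two subgroups lies in their product set, so a factorisation by the
intersection gives one by the product. -/
theorem Subgroup.mul_mul_eq_univ_of_mul_inf_eq_univ {G : Type*} [Group G] {K L M : Subgroup G}
    (h : (K : Set G) * ((L ⊓ M : Subgroup G) : Set G) = Set.univ) :
    (K : Set G) * ((L : Set G) * (M : Set G)) = Set.univ :=
  Set.eq_univ_of_subset
    (Set.mul_subset_mul_left fun x hx => ⟨x, hx.1, 1, M.one_mem, mul_one x⟩) h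

/-- Let `T` be a group and let `A, B, C ≤ T` form a strong
multiple factorisation: `T = A(B∩C) = B(C∩A) = C(A∩B)` (subset products).
Set `M = T³`, `K₁ = A × B × C`, `K₂ = B × C × A`, `K₃ = C × A × B`.  Then
`K₁ ∩ K₂ ∩ K₃ = (A∩B∩C)³`, `K_i ⬝ (K_j ∩ K_m) = M` for `{i,j,m} = {1,2,3}`,
and `K_i ⬝ (∏_{j ≠ i} K_j) = M` for every `i`.  Hence `{K₁, K₂, K₃}` is a
Cartesian system of subgroups in `M` with respect to the trivial coset `ω` in
the coset action of `M` on `[M : K₁ ∩ K₂ ∩ K₃]`. -/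
theorem strong_multiple_factorisation_cartesian_system_example
    {T : Type*} [Group T] (A B C : Subgroup T)
    (hA : (A : Set T) * ((B ⊓ C : Subgroup T) : Set T) = Set.univ)
    (hB : (B : Set T) * ((C ⊓ A : Subgroup T) : Set T) = Set.univ)
    (hC : (C : Set T) * ((A ⊓ B : Subgroup T) : Set T) = Set.univ)
    (K₁ K₂ K₃ : Subgroup (T × T × T))
    (h₁ : K₁ = A.prod (B.prod C))
    (h₂ : K₂ = B.prod (C.prod A))
    (h₃ : K₃ = C.prod (A.prod B)) :
    K₁ ⊓ K₂ ⊓ K₃ = (A ⊓ B ⊓ C).prod ((A ⊓ B ⊓ C).prod (A ⊓ B ⊓ C)) ∧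
    ((K₁ : Set (T × T × T)) * ((K₂ ⊓ K₃ : Subgroup (T × T × T)) : Set (T × T × T)) =
        Set.univ ∧
      (K₂ : Set (T × T × T)) * ((K₁ ⊓ K₃ : Subgroup (T × T × T)) : Set (T × T × T)) =
        Set.univ ∧
      (K₃ : Set (T × T × T)) * ((K₁ ⊓ K₂ : Subgroup (T × T × T)) : Set (T × T × T)) =
        Set.univ) ∧
    ((K₁ : Set (T × T × T)) * ((K₂ : Set (T × T × T)) * (K₃ : Set (T × T × T))) =
        Set.univ ∧
      (K₂ : Set (T × T × T)) * ((K₁ : Set (T × T × T)) * (K₃ : Set (T × T × T))) =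
        Set.univ ∧
      (K₃ : Set (T × T × T)) * ((K₁ : Set (T × T × T)) * (K₂ : Set (T × T × T))) =
        Set.univ) ∧
    MulAction.stabilizer (T × T × T)
        (QuotientGroup.mk 1 : (T × T × T) ⧸ (K₁ ⊓ K₂ ⊓ K₃)) = K₁ ⊓ K₂ ⊓ K₃ := by
  have hK₁ : (K₁ : Set (T × T × T)) * ((K₂ ⊓ K₃ : Subgroup (T × T × T)) : Set (T × T × T)) =
      Set.univ := by
    rw [h₁, h₂, h₃, Subgroup.prod_inf_prod, Subgroup.prod_inf_prod]
    exact Subgroup.coe_prod_mul_coe_prod_eq_univ hA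
      (Subgroup.coe_prod_mul_coe_prod_eq_univ hB hC)
  have hK₂ : (K₂ : Set (T × T × T)) * ((K₁ ⊓ K₃ : Subgroup (T × T × T)) : Set (T × T × T)) =
      Set.univ := by
    rw [inf_comm, h₁, h₂, h₃, Subgroup.prod_inf_prod, Subgroup.prod_inf_prod]
    exact Subgroup.coe_prod_mul_coe_prod_eq_univ hB
      (Subgroup.coe_prod_mul_coe_prod_eq_univ hC hA)
  have hK₃ : (K₃ : Set (T × T × T)) * ((K₁ ⊓ K₂ : Subgroup (T × T × T)) : Set (T × T × T)) =
      Set.univ := by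
    rw [h₁, h₂, h₃, Subgroup.prod_inf_prod, Subgroup.prod_inf_prod]
    exact Subgroup.coe_prod_mul_coe_prod_eq_univ hC
      (Subgroup.coe_prod_mul_coe_prod_eq_univ hA hB)
  refine ⟨?_, ⟨hK₁, hK₂, hK₃⟩, ⟨Subgroup.mul_mul_eq_univ_of_mul_inf_eq_univ hK₁,
    Subgroup.mul_mul_eq_univ_of_mul_inf_eq_univ hK₂,
    Subgroup.mul_mul_eq_univ_of_mul_inf_eq_univ hK₃⟩, MulAction.stabilizer_quotient _⟩
  have hBCA : B ⊓ C ⊓ A = A ⊓ B ⊓ C := by rw [inf_comm, inf_assoc]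
  have hCAB : C ⊓ A ⊓ B = A ⊓ B ⊓ C := by rw [inf_assoc, inf_comm]
  simp only [h₁, h₂, h₃, Subgroup.prod_inf_prod, hBCA, hCAB]
end
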